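/- Let n ≥ 2 be an even integer and ε > 0. Set c_{n,ε} = n/(n + nε − ε) and c'_{n,ε} = −n(1+ε)·log(2n)/(n + nε − ε) − n·log 2. Then c_{n,ε} > 0, and for every ABC-solution (a,b,c), f(Θ_n(a,b,c), ε/(n + (n−1)ε)) ≥ c_{n,ε}·f((a,b,c),ε) + c'_{n,ε}. -/

import Mathlib

/-- An ABC-solution: distinct, pairwise coprime integers with a+b+c = 0, a < 0, b < 0. -/
def IsABCSolution (a b c : ℤ) : Prop :=
  a + b + c = 0 ∧ a < 0 ∧ b < 0 ∧
  a ≠ b ∧ b ≠ c ∧ a ≠ c ∧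
  IsCoprime a b ∧ IsCoprime b c ∧ IsCoprime a c

/-- The radical of a natural number: the product of its distinct prime factors. -/
def rad (n : ℕ) : ℕ := ∏ p ∈ n.primeFactors, p

/-- The quality function f((a,b,c),ε) = log c − (1+ε)·log rad(|a·b·c|). -/
noncomputable def fABC (a b c : ℤ) (ε : ℝ) : ℝ :=
  Real.log (c : ℝ) - (1 + ε) * Real.log (rad (a * b * c).natAbs : ℝ)

/-- The operation Θ_n on ABC-solutions, with m = n if c is even and m = 0 otherwise.
The divisions are exact integer divisions. -/
def theta (n : ℕ) (a b c : ℤ) : ℤ × ℤ × ℤ :=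
  let m : ℕ := if 2 ∣ c then n else 0
  (-((a - b) ^ n / 2 ^ m), -((c ^ n - (a - b) ^ n) / 2 ^ m), c ^ n / 2 ^ m)

lemma rad_pos' (n : ℕ) : 0 < rad n :=
  Finset.prod_pos fun _ hp => (Nat.prime_of_mem_primeFactors hp).pos

lemma rad_mul_le (x y : ℕ) (hx : x ≠ 0) (hy : y ≠ 0) : rad (x * y) ≤ x * rad y := by
  unfold rad
  rw [Nat.primeFactors_mul hx hy, ← Finset.sdiff_union_self_eq_union,
    Finset.prod_union Finset.sdiff_disjoint]
  refine Nat.mul_le_mul_right _ (Nat.le_of_dvd (Nat.pos_of_ne_zero hx) ?_)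
  exact (Finset.prod_dvd_prod_of_subset _ _ _ Finset.sdiff_subset).trans
    (Nat.prod_primeFactors_dvd x)

lemma rad_le_of_dvd_pow (x y n : ℕ) (hy : y ≠ 0) (h : x ∣ y ^ n) : rad x ≤ rad y := by
  have h1 : x.primeFactors ⊆ y.primeFactors := by
    refine (Nat.primeFactors_mono h (pow_ne_zero _ hy)).trans ?_
    rcases Nat.eq_zero_or_pos n with rfl | hn
    · simp
    · rw [Nat.primeFactors_pow _ hn.ne']
  exact Nat.le_of_dvd (rad_pos' y) (Finset.prod_dvd_prod_of_subset _ _ _ h1)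

lemma exists_S (k : ℕ) (hk : 1 ≤ k) (c d : ℤ) (hd : d ≠ 0) (h : |d| ≤ c) :
    ∃ S : ℤ, c ^ (2 * k) - d ^ (2 * k) = (c ^ 2 - d ^ 2) * S ∧ 0 < S ∧
      S ≤ k * c ^ (2 * (k - 1)) := by
  have hc : 0 < c := lt_of_lt_of_le (abs_pos.2 hd) h
  have hdc : d ^ 2 ≤ c ^ 2 := sq_le_sq' (by linarith [neg_abs_le d]) (by linarith [le_abs_self d])
  have hd2 : 0 < d ^ 2 := by positivity
  refine ⟨∑ i ∈ Finset.range k, (c ^ 2) ^ i * (d ^ 2) ^ (k - 1 - i), ?_, ?_, ?_⟩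
  · rw [pow_mul, pow_mul, mul_comm, geom_sum₂_mul]
  · refine Finset.sum_pos (fun i _ => by positivity) ⟨0, by simp; omega⟩
  · calc _ ≤ ∑ i ∈ Finset.range k, c ^ (2 * (k - 1)) := by
          refine Finset.sum_le_sum fun i hi => ?_
          have : i < k := Finset.mem_range.1 hi
          calc (c ^ 2) ^ i * (d ^ 2) ^ (k - 1 - i) ≤ (c ^ 2) ^ i * (c ^ 2) ^ (k - 1 - i) := by
                gcongr
            _ = c ^ (2 * (k - 1)) := by
                rw [← pow_add, ← pow_mul]; congr 2; omega
      _ = _ := by simp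

lemma rad_theta (n : ℕ) (hn : 2 ≤ n) (hev : Even n) (a b c : ℤ) (h : IsABCSolution a b c) :
    (c : ℝ) ^ n / 2 ^ n ≤ ((theta n a b c).2.2 : ℝ) ∧
    (rad ((theta n a b c).1 * (theta n a b c).2.1 * (theta n a b c).2.2).natAbs : ℤ) ≤
      2 * n * rad (a * b * c).natAbs * c ^ (n - 1) := by
  obtain ⟨hs, ha, hb, hab, -, -, cab, -, -⟩ := h
  have hc : 0 < c := by linarith
  have hd : a - b ≠ 0 := sub_ne_zero.2 hab
  have hdc : |a - b| ≤ c := abs_le.2 ⟨by linarith, by linarith⟩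
  obtain ⟨k, rfl⟩ := hev
  rw [← two_mul] at *
  obtain ⟨S, hS, hS0, hSk⟩ := exists_S k (by omega) c (a - b) hd hdc
  have e4 : c ^ 2 - (a - b) ^ 2 = 4 * (a * b) := by
    have : c = -(a + b) := by linarith
    rw [this]; ring
  rw [e4] at hS
  have key : ∃ m : ℕ, m ≤ 2 * k ∧ (theta (2 * k) a b c) =
      (-((a - b) ^ (2*k) / 2 ^ m), -((c ^ (2*k) - (a - b) ^ (2*k)) / 2 ^ m), c ^ (2*k) / 2 ^ m) ∧
      (2:ℤ) ^ m ∣ c ^ (2*k) ∧ (2:ℤ) ^ m ∣ (a - b) ^ (2*k) := by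
    by_cases h2 : (2:ℤ) ∣ c
    · refine ⟨2 * k, le_rfl, by simp [theta, h2], pow_dvd_pow_of_dvd h2 _,
        pow_dvd_pow_of_dvd ?_ _⟩
      omega
    · exact ⟨0, by omega, by simp [theta, h2], by simp, by simp⟩
  obtain ⟨m, hm, ht, hmc, hmd⟩ := key
  rw [ht]
  dsimp only
  constructor
  · rw [Int.cast_div hmc (by positivity)]
    push_cast
    have : (0:ℝ) < c := by exact_mod_cast hc
    gcongr
    norm_num
  · set P := -((a - b) ^ (2*k) / 2 ^ m) * -((c ^ (2*k) - (a - b) ^ (2*k)) / 2 ^ m) *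
      (c ^ (2*k) / 2 ^ m) with hP
    have hPd : P ∣ ((2 * (a - b) * S) * (a * b * c)) ^ (2 * k) := by
      have h1 : P ∣ (a - b) ^ (2*k) * (c ^ (2*k) - (a - b) ^ (2*k)) * c ^ (2*k) := by
        refine mul_dvd_mul (mul_dvd_mul ?_ ?_) ?_
        · exact (neg_dvd).2 (Int.ediv_dvd_of_dvd hmd)
        · exact (neg_dvd).2 (Int.ediv_dvd_of_dvd (dvd_sub hmc hmd))
        · exact Int.ediv_dvd_of_dvd hmc
      refine h1.trans ?_
      rw [hS]
      obtain ⟨j, hj⟩ : ∃ j, 2 * k = j + 2 := ⟨2 * k - 2, by omega⟩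
      rw [hj]
      refine ⟨2 ^ j * S ^ (j+1) * a ^ (j+1) * b ^ (j+1), ?_⟩
      simp only [mul_pow, pow_succ]
      ring
    have hx : (2 * (a - b) * S).natAbs ≠ 0 := by
      simp only [ne_eq, Int.natAbs_eq_zero]; positivity
    have hy : (a * b * c).natAbs ≠ 0 := by
      simp only [ne_eq, Int.natAbs_eq_zero]
      exact mul_ne_zero (mul_ne_zero ha.ne hb.ne) hc.ne'
    have h3 : rad P.natAbs ≤ (2 * (a - b) * S).natAbs * rad (a * b * c).natAbs := by
      refine (rad_le_of_dvd_pow _ _ (2 * k) (mul_ne_zero hx hy) ?_).trans (rad_mul_le _ _ hx hy)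
      rw [← Int.natAbs_mul, ← Int.natAbs_pow]
      exact Int.natAbs_dvd_natAbs.2 hPd
    have h4 : (rad P.natAbs : ℤ) ≤ (2 * |a - b| * S) * rad (a * b * c).natAbs := by
      have : (rad P.natAbs : ℤ) ≤ ((2 * (a - b) * S).natAbs : ℤ) * rad (a * b * c).natAbs := by
        exact_mod_cast h3
      rwa [Int.natCast_natAbs, abs_mul, abs_mul, abs_of_pos hS0, abs_two] at this
    refine h4.trans ?_
    calc _ ≤ (2 * c * (k * c ^ (2 * (k - 1)))) * (rad (a * b * c).natAbs : ℤ) := by gcongr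
      _ = k * (2 * rad (a * b * c).natAbs * c ^ (2 * k - 1)) := by
        have : 2 * k - 1 = 2 * (k - 1) + 1 := by omega
        rw [this, pow_succ]; ring
      _ ≤ (2 * (2 * k : ℕ)) * rad (a * b * c).natAbs * c ^ (2 * k - 1) := by
        have : 0 ≤ (k:ℤ) * (rad (a * b * c).natAbs * c ^ (2 * k - 1)) := by positivity
        push_cast
        linarith

/-- the key inequality relating f of Θ_n(a,b,c) to f of (a,b,c). -/
theorem f_theta_ge (n : ℕ) (hn : 2 ≤ n) (hev : Even n) (ε : ℝ) (hε : 0 < ε) :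
    0 < (n : ℝ) / (n + n * ε - ε) ∧
    ∀ a b c : ℤ, IsABCSolution a b c →
      fABC (theta n a b c).1 (theta n a b c).2.1 (theta n a b c).2.2
          (ε / (n + ((n : ℝ) - 1) * ε)) ≥
        ((n : ℝ) / (n + n * ε - ε)) * fABC a b c ε +
          (-(n : ℝ) * (1 + ε) * Real.log (2 * n) / (n + n * ε - ε)
            - n * Real.log 2) := by
  have hn' : (2:ℝ) ≤ n := by exact_mod_cast hn
  have hD : (0:ℝ) < n + n * ε - ε := by nlinarith
  refine ⟨by positivity, fun a b c h => ?_⟩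
  obtain ⟨h1, h2⟩ := rad_theta n hn hev a b c h
  have hc : 0 < c := by obtain ⟨hs, ha, hb, -⟩ := h; linarith
  have hc' : (0:ℝ) < c := by exact_mod_cast hc
  unfold fABC
  set C := (theta n a b c).2.2
  set N := rad ((theta n a b c).1 * (theta n a b c).2.1 * C).natAbs
  have hN : (0:ℝ) < N := by exact_mod_cast rad_pos' _
  set R := rad (a * b * c).natAbs
  have hR : (0:ℝ) < R := by exact_mod_cast rad_pos' _
  have h2' : (N:ℝ) ≤ 2 * n * R * c ^ (n - 1) := by exact_mod_cast h2
  have l1 : n * Real.log c - n * Real.log 2 ≤ Real.log C := by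
    have := Real.log_le_log (by positivity) h1
    rwa [Real.log_div (by positivity) (by positivity), Real.log_pow, Real.log_pow] at this
  have l2 : Real.log N ≤ Real.log (2 * n) + Real.log R + (n - 1) * Real.log c := by
    have := Real.log_le_log hN h2'
    rwa [Real.log_mul (by positivity) (by positivity), Real.log_mul (by positivity) (by positivity),
      Real.log_pow, Nat.cast_sub (by omega), Nat.cast_one] at this
  have eD : (n : ℝ) + ((n : ℝ) - 1) * ε = n + n * ε - ε := by ring
  rw [eD]
  generalize Real.log (2 * n) = L at *
  generalize Real.log N = x at *
  generalize Real.log R = r at *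
  generalize Real.log c = y at *
  generalize hDe : (n:ℝ) + n * ε - ε = D at *
  replace hDe := hDe.symm
  have hD0 := hD.ne'
  have e1 : 1 + ε / (D) = n * (1 + ε) / (D) := by
    field_simp; rw [hDe]; ring
  rw [e1]
  have l3 : n * (1 + ε) / (D) * x ≤
      n * (1 + ε) / (D) * (L + r + (n - 1) * y) := by gcongr
  have e2 : n / (D) * (y - (1 + ε) * r) + (-n * (1 + ε) * L / (D))
      = n * y - n * (1 + ε) / (D) * (L + r + (n - 1) * y) := by
    field_simp; rw [hDe]; ring
  linarith
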